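/- arXiv:1709.08262 — 2 statements merged into one kernel-verified Lean document; each statement's English description precedes it below -/
import Mathlib

section
/- Let E ⊂ R^n be a measurable set of finite Lebesgue measure with P(E) = ∞. Then limsup_{ε→0⁺} (1/|log ε|) ‖γ_ε ∗ 1_E‖_{H^{1/2}}^2 = ∞. -/
open MeasureTheory Filter Topology Real
open scoped FourierTransform RealInnerProductSpace ENNReal

noncomputable section

variable {V : Type*} [NormedAddCommGroup V] [InnerProductSpace ℝ V]
  [FiniteDimensional ℝ V] [MeasurableSpace V] [BorelSpace V] [MeasureSpace V]

/-- convolution of two real-valued functions -/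
def conv (f g : V → ℝ) (x : V) : ℝ := ∫ y, f y * g (x - y)

/-- the standard Gaussian `γ(x) = (2π)^{-n/2} exp(-|x|²/2)` -/
def gauss (x : V) : ℝ :=
  (2 * π) ^ (-(Module.finrank ℝ V : ℝ) / 2) * Real.exp (-‖x‖ ^ 2 / 2)

/-- the scaled function `f_r(x) = r^{-n} f(x/r)` -/
def scaleFn (f : V → ℝ) (r : ℝ) (x : V) : ℝ := r⁻¹ ^ (Module.finrank ℝ V) * f (r⁻¹ • x)

/-- the scaled Gaussian `γ_ε` -/
def gaussSc (ε : ℝ) (x : V) : ℝ := scaleFn gauss ε x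

/-- the squared `H^{1/2}` seminorm `∫ |ξ| |û(ξ)|² dξ` (extended-real valued) -/
def H12e (u : V → ℝ) : ℝ≥0∞ :=
  ∫⁻ ξ, (‖ξ‖₊ : ℝ≥0∞) * (‖𝓕 (fun x => (u x : ℂ)) ξ‖₊ : ℝ≥0∞) ^ 2

/-- divergence of a vector field on ℝⁿ -/
def divg {n : ℕ} (φ : EuclideanSpace ℝ (Fin n) → EuclideanSpace ℝ (Fin n))
    (x : EuclideanSpace ℝ (Fin n)) : ℝ :=
  ∑ i, fderiv ℝ φ x (EuclideanSpace.single i 1) i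

/-- perimeter of a set: `P(E) = sup { ∫_E div φ : φ ∈ C_c¹, ‖φ‖ ≤ 1 }` -/
def perim {n : ℕ} (E : Set (EuclideanSpace ℝ (Fin n))) : ℝ≥0∞ :=
  ⨆ (φ : EuclideanSpace ℝ (Fin n) → EuclideanSpace ℝ (Fin n))
    (_ : ContDiff ℝ 1 φ) (_ : HasCompactSupport φ) (_ : ∀ x, ‖φ x‖ ≤ 1),
    ENNReal.ofReal (∫ x in E, divg φ x)

theorem fourier_L2_ae {n : ℕ} (f : EuclideanSpace ℝ (Fin n) → ℂ) (h1 : Integrable f)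
    (h2 : MemLp f 2) :
    ∀ᵐ x, 𝓕 f x = (𝓕 (h2.toLp f) : Lp ℂ 2 (volume : Measure (EuclideanSpace ℝ (Fin n)))) x := by
  have hcont : Continuous (𝓕 f) :=
    VectorFourier.fourierIntegral_continuous Real.continuous_fourierChar
      (by exact continuous_inner) h1
  apply ae_eq_of_integral_contDiff_smul_eq
  · exact hcont.locallyIntegrable
  · exact (Lp.memLp _).locallyIntegrable (by norm_num)
  · intro g hg hgs
    have hgs' : HasCompactSupport (fun x => (g x : ℂ)) :=
      hgs.comp_left (g := fun t : ℝ => (t : ℂ)) (by simp)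
    have hg' : ContDiff ℝ (⊤ : ℕ∞) (fun x => (g x : ℂ)) := Complex.ofRealCLM.contDiff.comp hg
    let G : SchwartzMap (EuclideanSpace ℝ (Fin n)) ℂ := hgs'.toSchwartzMap hg'
    have hG : ∀ x, G x = (g x : ℂ) := fun x => rfl
    have key := congrArg (fun T => T G) (Lp.fourier_toTemperedDistribution_eq (h2.toLp f))
    simp only [TemperedDistribution.fourier_apply, Lp.toTemperedDistribution_apply] at key
    have e1 : ∫ x, (𝓕 G) x • (h2.toLp f) x = ∫ x, f x • (𝓕 (G : EuclideanSpace ℝ (Fin n) → ℂ)) x := by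
      apply integral_congr_ae
      filter_upwards [h2.coeFn_toLp] with x hx
      rw [hx, smul_eq_mul, smul_eq_mul, mul_comm]
      rfl
    have e2 := VectorFourier.integral_fourierIntegral_smul_eq_flip (μ := volume) (ν := volume)
      (L := innerₗ (EuclideanSpace ℝ (Fin n))) (f := f) (g := (G : EuclideanSpace ℝ (Fin n) → ℂ))
      Real.continuous_fourierChar (by exact continuous_inner) h1 G.integrable
    rw [flip_innerₗ] at e2
    have e3 : ∫ x, f x • (𝓕 (G : EuclideanSpace ℝ (Fin n) → ℂ)) x = ∫ x, 𝓕 f x • G x := e2.symm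
    rw [e1, e3] at key
    simp only [hG] at key
    simp only [smul_eq_mul, Complex.real_smul] at key ⊢
    rw [← key]
    congr 1; ext x; ring

theorem plancherel {n : ℕ} (f : EuclideanSpace ℝ (Fin n) → ℂ) (h1 : Integrable f)
    (h2 : MemLp f 2) :
    ∫⁻ x, ‖f x‖ₑ ^ 2 = ∫⁻ x, ‖𝓕 f x‖ₑ ^ 2 := by
  have h := Lp.norm_fourier_eq (h2.toLp f)
  rw [Lp.norm_def, Lp.norm_def, ENNReal.toReal_eq_toReal_iff' (Lp.eLpNorm_ne_top _)
    (Lp.eLpNorm_ne_top _), eLpNorm_congr_ae h2.coeFn_toLp,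
    ← eLpNorm_congr_ae (fourier_L2_ae f h1 h2)] at h
  rw [eLpNorm_eq_lintegral_rpow_enorm_toReal (by norm_num) (by norm_num),
    eLpNorm_eq_lintegral_rpow_enorm_toReal (by norm_num) (by norm_num)] at h
  have := ENNReal.rpow_left_injective (x := 1 / (2 : ℝ≥0∞).toReal) (by norm_num) h
  simpa using this.symm

theorem gaussSc_eq {n : ℕ} (ε : ℝ) (x : EuclideanSpace ℝ (Fin n)) :
    ((gaussSc ε x : ℝ) : ℂ) = ((ε⁻¹ ^ n * (2 * π) ^ (-(n : ℝ) / 2) : ℝ) : ℂ) *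
      Complex.exp (-((1 / (2 * ε ^ 2) : ℝ) : ℂ) * ‖x‖ ^ 2) := by
  unfold gaussSc scaleFn gauss
  rw [finrank_euclideanSpace_fin, norm_smul, ← mul_assoc]
  push_cast
  congr 2
  simp only [norm_inv, Real.norm_eq_abs, mul_pow, inv_pow, Complex.ofReal_inv]
  rw [← Complex.ofReal_pow |ε|, sq_abs]
  push_cast
  field_simp

theorem fourier_gaussSc {n : ℕ} {ε : ℝ} (hε : 0 < ε) (ξ : EuclideanSpace ℝ (Fin n)) :
    𝓕 (fun x : EuclideanSpace ℝ (Fin n) => ((gaussSc ε x : ℝ) : ℂ)) ξ =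
      ((Real.exp (-2 * π ^ 2 * ε ^ 2 * ‖ξ‖ ^ 2) : ℝ) : ℂ) := by
  have hb : 0 < 1 / (2 * ε ^ 2) := by positivity
  have h0 : (fun x : EuclideanSpace ℝ (Fin n) => ((gaussSc ε x : ℝ) : ℂ)) =
      ((ε⁻¹ ^ n * (2 * π) ^ (-(n : ℝ) / 2) : ℝ) : ℂ) •
      (fun x => Complex.exp (-((1 / (2 * ε ^ 2) : ℝ) : ℂ) * ‖x‖ ^ 2)) := by
    ext x; rw [gaussSc_eq]; rfl
  have hF := fourier_gaussian_innerProductSpace (V := EuclideanSpace ℝ (Fin n))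
    (b := ((1 / (2 * ε ^ 2) : ℝ) : ℂ)) (by rw [Complex.ofReal_re]; exact hb) ξ
  rw [h0, Real.fourier_eq]
  simp only [Pi.smul_apply]
  have : ∀ v : EuclideanSpace ℝ (Fin n), Real.fourierChar (-inner ℝ v ξ) •
      (((ε⁻¹ ^ n * (2 * π) ^ (-(n : ℝ) / 2) : ℝ) : ℂ) •
        Complex.exp (-((1 / (2 * ε ^ 2) : ℝ) : ℂ) * ‖v‖ ^ 2)) =
      ((ε⁻¹ ^ n * (2 * π) ^ (-(n : ℝ) / 2) : ℝ) : ℂ) • (Real.fourierChar (-inner ℝ v ξ) •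
        Complex.exp (-((1 / (2 * ε ^ 2) : ℝ) : ℂ) * ‖v‖ ^ 2)) := fun v => smul_comm _ _ _
  simp only [this]
  rw [integral_smul, ← Real.fourier_eq, hF, finrank_euclideanSpace_fin]
  have e1 : ((π : ℂ) / ((1 / (2 * ε ^ 2) : ℝ) : ℂ)) ^ ((n : ℂ) / 2) =
      (((2 * π * ε ^ 2) ^ ((n : ℝ) / 2) : ℝ) : ℂ) := by
    rw [Complex.ofReal_cpow (by positivity)]
    congr 1
    · push_cast; field_simp
    · push_cast; rfl
  have e2 : Complex.exp (-(π : ℂ) ^ 2 * ‖ξ‖ ^ 2 / ((1 / (2 * ε ^ 2) : ℝ) : ℂ)) =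
      ((Real.exp (-2 * π ^ 2 * ε ^ 2 * ‖ξ‖ ^ 2) : ℝ) : ℂ) := by
    have hεc : (ε : ℂ) ≠ 0 := by exact_mod_cast hε.ne'
    push_cast; congr 1; field_simp
  rw [e1, e2, smul_eq_mul, ← mul_assoc, ← Complex.ofReal_mul]
  have e3 : ε⁻¹ ^ n * (2 * π) ^ (-(n : ℝ) / 2) * (2 * π * ε ^ 2) ^ ((n : ℝ) / 2) = 1 := by
    rw [Real.mul_rpow (x := 2 * π) (y := ε ^ 2) (by positivity) (by positivity), neg_div, Real.rpow_neg (by positivity),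
      ← Real.rpow_natCast ε 2, ← Real.rpow_mul hε.le]
    have : ((2 : ℕ) : ℝ) * ((n : ℝ) / 2) = n := by push_cast; ring
    rw [this, Real.rpow_natCast, inv_pow]
    have hp : (2 * π) ^ ((n : ℝ) / 2) ≠ 0 := by positivity
    field_simp
  rw [e3]; simp

theorem integrable_gaussSc {n : ℕ} {ε : ℝ} (hε : 0 < ε) :
    Integrable (fun x : EuclideanSpace ℝ (Fin n) => ((gaussSc ε x : ℝ) : ℂ)) := by
  have hb : 0 < 1 / (2 * ε ^ 2) := by positivity
  simp_rw [gaussSc_eq]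
  apply Integrable.const_mul
  have := GaussianFourier.integrable_cexp_neg_mul_sq_norm_add (V := EuclideanSpace ℝ (Fin n))
    (b := ((1 / (2 * ε ^ 2) : ℝ) : ℂ)) (by rw [Complex.ofReal_re]; exact hb) 0 0
  simpa using this

/-- complex indicator -/
def indC {n : ℕ} (E : Set (EuclideanSpace ℝ (Fin n))) : EuclideanSpace ℝ (Fin n) → ℂ :=
  E.indicator fun _ => (1 : ℂ)

theorem integrable_indC {n : ℕ} {E : Set (EuclideanSpace ℝ (Fin n))} (hE : MeasurableSet E)
    (hEvol : volume E < ⊤) : Integrable (indC E) :=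
  (integrable_indicator_iff hE).2 (integrableOn_const hEvol.ne)

theorem memLp_indC {n : ℕ} {E : Set (EuclideanSpace ℝ (Fin n))} (hE : MeasurableSet E)
    (hEvol : volume E < ⊤) : MemLp (indC E) 2 :=
  memLp_indicator_const 2 hE 1 (Or.inr hEvol.ne)

theorem H12e_eq {n : ℕ} {E : Set (EuclideanSpace ℝ (Fin n))} (hE : MeasurableSet E)
    (hEvol : volume E < ⊤) {ε : ℝ} (hε : 0 < ε) :
    H12e (conv (gaussSc ε) (E.indicator fun _ => (1 : ℝ))) =
      ∫⁻ ξ, ENNReal.ofReal (‖ξ‖ * Real.exp (-4 * π ^ 2 * ε ^ 2 * ‖ξ‖ ^ 2)) *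
        ‖𝓕 (indC E) ξ‖ₑ ^ 2 := by
  have h1 : (fun x => ((conv (gaussSc ε) (E.indicator fun _ => (1 : ℝ)) x : ℝ) : ℂ)) =
      MeasureTheory.convolution (fun x : EuclideanSpace ℝ (Fin n) => ((gaussSc ε x : ℝ) : ℂ))
        (indC E) (ContinuousLinearMap.mul ℂ ℂ) volume := by
    ext x
    unfold conv MeasureTheory.convolution
    rw [← integral_complex_ofReal]
    congr 1; ext y
    simp only [Complex.ofReal_mul, ContinuousLinearMap.mul_apply', indC]
    congr 1
    by_cases h : x - y ∈ E <;> simp [h]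
  unfold H12e
  rw [h1]
  apply lintegral_congr
  intro ξ
  rw [Real.fourier_mul_convolution_eq (integrable_gaussSc hε) (integrable_indC hE hEvol),
    fourier_gaussSc hε, ← enorm_eq_nnnorm, ← enorm_eq_nnnorm, enorm_mul, mul_pow, ← mul_assoc]
  congr 1
  rw [← ofReal_norm, ← ofReal_norm, ← ENNReal.ofReal_pow (norm_nonneg _),
    ← ENNReal.ofReal_mul (norm_nonneg _), Complex.norm_real, Real.norm_eq_abs, Real.abs_exp,
    ← Real.exp_nat_mul]
  congr 3; push_cast; ring

theorem diff_bound {n : ℕ} {E : Set (EuclideanSpace ℝ (Fin n))} (hE : MeasurableSet E)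
    (hEvol : volume E < ⊤) (v : EuclideanSpace ℝ (Fin n)) :
    ∫⁻ x, ‖indC E (x + v) - indC E x‖ₑ ^ 2 ≤
      ∫⁻ ξ, ENNReal.ofReal (4 * min 1 ((π * ‖v‖ * ‖ξ‖) ^ 2)) * ‖𝓕 (indC E) ξ‖ₑ ^ 2 := by
  have hi := integrable_indC hE hEvol
  have hm := memLp_indC hE hEvol
  have hi' : Integrable (fun x => indC E (x + v)) := hi.comp_add_right v
  have hm' : MemLp (fun x => indC E (x + v)) 2 :=
    hm.comp_measurePreserving (measurePreserving_add_right volume v)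
  have hF : ∀ ξ, 𝓕 (fun x => indC E (x + v) - indC E x) ξ =
      ((Real.fourierChar (inner ℝ v ξ) : ℂ) - 1) * 𝓕 (indC E) ξ := by
    intro ξ
    have e1 : 𝓕 (fun x => indC E (x + v)) ξ = Real.fourierChar (inner ℝ v ξ) • 𝓕 (indC E) ξ :=
      congrFun (VectorFourier.fourierIntegral_comp_add_right Real.fourierChar volume
        (innerₗ (EuclideanSpace ℝ (Fin n))) (indC E) v) ξ
    have e2 : 𝓕 (fun x => indC E (x + v) - indC E x) ξ =
        𝓕 (fun x => indC E (x + v)) ξ - 𝓕 (indC E) ξ := by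
      simp only [Real.fourier_eq]
      rw [← integral_sub ((Real.fourierIntegral_convergent_iff ξ).2 hi')
        ((Real.fourierIntegral_convergent_iff ξ).2 hi)]
      simp only [smul_sub]
    rw [e2, e1, Circle.smul_def, smul_eq_mul]; ring
  rw [plancherel (fun x => indC E (x + v) - indC E x) (hi'.sub hi) (hm'.sub hm)]
  apply lintegral_mono
  intro ξ
  simp only [hF, enorm_mul, mul_pow]
  gcongr
  rw [← ofReal_norm, ← ENNReal.ofReal_pow (norm_nonneg _)]
  apply ENNReal.ofReal_le_ofReal
  have b1 : ‖(Real.fourierChar (inner ℝ v ξ) : ℂ) - 1‖ ≤ 2 := by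
    refine (norm_sub_le _ _).trans ?_
    rw [Circle.norm_coe, norm_one]; norm_num
  have b2 : ‖(Real.fourierChar (inner ℝ v ξ) : ℂ) - 1‖ ≤ 2 * (π * ‖v‖ * ‖ξ‖) := by
    rw [Real.fourierChar_apply, mul_comm _ Complex.I]
    refine (Real.norm_exp_I_mul_ofReal_sub_one_le).trans ?_
    rw [norm_mul, Real.norm_eq_abs (2 * π), abs_of_pos (by positivity)]
    have := norm_inner_le_norm (𝕜 := ℝ) v ξ
    nlinarith [Real.pi_pos]
  have b0 := norm_nonneg ((Real.fourierChar (inner ℝ v ξ) : ℂ) - 1)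
  rw [mul_min_of_nonneg _ _ (by norm_num : (0:ℝ) ≤ 4), le_min_iff]
  constructor
  · nlinarith
  · nlinarith

theorem T_le (y : ℝ) (hy : 0 ≤ y) (N : ℕ) :
    ∑ k ∈ Finset.range N, min ((2:ℝ) ^ k) (y ^ 2 / 2 ^ k) ≤ 2 ^ N ∧
    (y < 2 ^ N → ∑ k ∈ Finset.range N, min ((2:ℝ) ^ k) (y ^ 2 / 2 ^ k) ≤
      4 * y - 2 * (y ^ 2 / 2 ^ N)) := by
  induction N with
  | zero => simp; intro h; nlinarith
  | succ N ih =>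
    obtain ⟨h1, h2⟩ := ih
    have hp : (0:ℝ) < 2 ^ N := by positivity
    rw [Finset.sum_range_succ]
    have m1 := min_le_left ((2:ℝ) ^ N) (y ^ 2 / 2 ^ N)
    have m2 := min_le_right ((2:ℝ) ^ N) (y ^ 2 / 2 ^ N)
    have e : y ^ 2 / 2 ^ (N + 1) = (y ^ 2 / 2 ^ N) / 2 := by rw [pow_succ (2:ℝ) N]; field_simp
    rw [e, pow_succ (2:ℝ) N]
    refine ⟨by linarith, fun h => ?_⟩
    by_cases hy2 : y < 2 ^ N
    · have := h2 hy2
      linarith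
    · push Not at hy2
      have : y ^ 2 / 2 ^ N ≤ 4 * y - 2 * 2 ^ N := by
        rw [div_le_iff₀ hp]
        nlinarith
      linarith

theorem num_main (y : ℝ) (hy : 0 ≤ y) (N : ℕ) :
    ∃ j : ℕ, ∑ k ∈ Finset.range N, min ((2:ℝ) ^ k) (y ^ 2 / 2 ^ k) ≤
      4 * Real.exp 16 * ((1 / 2) ^ j * (y * Real.exp (-4 * (y / 2 ^ (N + j)) ^ 2))) := by
  obtain ⟨h1, h2⟩ := T_le y hy N
  by_cases hy2 : y < 2 ^ N
  · refine ⟨0, ?_⟩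
    have h3 := h2 hy2
    have h4 : 0 ≤ y ^ 2 / 2 ^ N := by positivity
    have h5 : (y / 2 ^ (N + 0)) ^ 2 ≤ 1 := by
      apply pow_le_one₀ (by positivity)
      rw [div_le_one (by positivity)]; exact hy2.le
    have h6 : 1 ≤ Real.exp 16 * Real.exp (-4 * (y / 2 ^ (N + 0)) ^ 2) := by
      rw [← Real.exp_add]; apply Real.one_le_exp; linarith
    rw [pow_zero, one_mul]
    nlinarith
  · push Not at hy2
    have hp : (0:ℝ) < 2 ^ N := by positivity
    obtain ⟨j, hj1, hj2⟩ := exists_nat_pow_near (x := y / 2 ^ N) (y := (2:ℝ))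
      (by rw [le_div_iff₀ hp]; linarith) (by norm_num)
    refine ⟨j, h1.trans ?_⟩
    have hpj : (0:ℝ) < 2 ^ j := by positivity
    have h5 : (y / 2 ^ (N + j)) ^ 2 ≤ 4 := by
      have : y / 2 ^ (N + j) ≤ 2 := by
        rw [div_lt_iff₀ hp, pow_succ (2:ℝ) j] at hj2
        rw [div_le_iff₀ (by positivity), pow_add]
        linarith
      have h0 : 0 ≤ y / 2 ^ (N + j) := by positivity
      nlinarith
    have h6 : 1 ≤ Real.exp 16 * Real.exp (-4 * (y / 2 ^ (N + j)) ^ 2) := by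
      rw [← Real.exp_add]; apply Real.one_le_exp; linarith
    have h7 : (2:ℝ) ^ N ≤ (1 / 2) ^ j * y := by
      rw [le_div_iff₀ hp] at hj1
      rw [one_div, inv_pow, inv_mul_eq_div, le_div_iff₀ hpj]; linarith
    have h8 : 0 ≤ (1 / 2) ^ j * y := by positivity
    nlinarith

theorem num_enn (x : ℝ) (hx : 0 ≤ x) (N : ℕ) :
    ∑ k ∈ Finset.range N, 2 ^ k * ENNReal.ofReal (4 * min 1 ((π * (1 / 2) ^ k * x) ^ 2)) ≤
      ENNReal.ofReal (16 * π * Real.exp 16) * ∑' j : ℕ, ENNReal.ofReal ((1 / 2) ^ j) *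
        ENNReal.ofReal (x * Real.exp (-4 * π ^ 2 * ((1 / 2) ^ (N + j)) ^ 2 * x ^ 2)) := by
  obtain ⟨j, hj⟩ := num_main (π * x) (by positivity) N
  refine le_trans ?_ (mul_le_mul_right (ENNReal.le_tsum j) _)
  rw [← ENNReal.ofReal_mul (by positivity), ← ENNReal.ofReal_mul (by positivity)]
  have e1 : ∀ k : ℕ, (2:ℝ≥0∞) ^ k * ENNReal.ofReal (4 * min 1 ((π * (1 / 2) ^ k * x) ^ 2)) =
      ENNReal.ofReal (4 * min ((2:ℝ) ^ k) ((π * x) ^ 2 / 2 ^ k)) := by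
    intro k
    have : (2:ℝ≥0∞) ^ k = ENNReal.ofReal (2 ^ k) := by
      rw [ENNReal.ofReal_pow (by norm_num)]; norm_num
    rw [this, ← ENNReal.ofReal_mul (by positivity)]
    congr 1
    rw [mul_left_comm, mul_min_of_nonneg _ _ (by positivity : (0:ℝ) ≤ 2 ^ k), mul_one]
    congr 2
    rw [one_div, inv_pow]
    field_simp
  simp_rw [e1]
  rw [← ENNReal.ofReal_sum_of_nonneg (fun k _ => by positivity), ← Finset.mul_sum]
  apply ENNReal.ofReal_le_ofReal
  have e2 : -4 * π ^ 2 * ((1 / 2) ^ (N + j)) ^ 2 * x ^ 2 = -4 * (π * x / 2 ^ (N + j)) ^ 2 := by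
    rw [one_div, inv_pow]
    field_simp
  rw [e2]
  nlinarith

theorem tsum_finite : ∑' j : ℕ, ENNReal.ofReal ((1 / 2) ^ j) * ((j : ℝ≥0∞) + 1) ≠ ⊤ := by
  have hs : Summable (fun j : ℕ => ((1:ℝ) / 2) ^ j * ((j:ℝ) + 1)) := by
    have h1 := summable_pow_mul_geometric_of_norm_lt_one (R := ℝ) 1 (r := 1 / 2) (by norm_num)
    have h2 := summable_geometric_of_lt_one (r := (1:ℝ) / 2) (by norm_num) (by norm_num)
    refine (h1.add h2).congr fun j => ?_
    ring
  have : ∀ j : ℕ, ENNReal.ofReal ((1 / 2) ^ j) * ((j : ℝ≥0∞) + 1) =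
      ENNReal.ofReal (((1:ℝ) / 2) ^ j * ((j:ℝ) + 1)) := by
    intro j
    rw [ENNReal.ofReal_mul (by positivity), ENNReal.ofReal_add (by positivity) (by norm_num)]
    simp
  simp_rw [this]
  exact hs.tsum_ofReal_ne_top

theorem sum_bound {α : Type*} [MeasurableSpace α] (μ : Measure α) (r : α → ℝ) (hr : Measurable r)
    (hr0 : ∀ x, 0 ≤ r x) (w : α → ℝ≥0∞) (hw : Measurable w) (C : ℝ≥0∞) (hC : C ≠ ⊤) (K : ℕ)
    (ha : ∀ m : ℕ, K ≤ m → ∫⁻ x, ENNReal.ofReal (r x * Real.exp (-4 * π ^ 2 * ((1 / 2) ^ m) ^ 2 *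
      r x ^ 2)) * w x ∂μ ≤ C * m) :
    ∃ B : ℝ≥0∞, B ≠ ⊤ ∧ ∀ N : ℕ, K ≤ N → 1 ≤ N →
      ∑ k ∈ Finset.range N, 2 ^ k *
        ∫⁻ x, ENNReal.ofReal (4 * min 1 ((π * (1 / 2) ^ k * r x) ^ 2)) * w x ∂μ ≤ B * N := by
  refine ⟨ENNReal.ofReal (16 * π * Real.exp 16) * (C * ∑' j : ℕ, ENNReal.ofReal ((1 / 2) ^ j) *
    ((j : ℝ≥0∞) + 1)), ?_, ?_⟩
  · exact ENNReal.mul_ne_top ENNReal.ofReal_ne_top (ENNReal.mul_ne_top hC tsum_finite)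
  intro N hKN hN
  calc ∑ k ∈ Finset.range N, 2 ^ k *
        ∫⁻ x, ENNReal.ofReal (4 * min 1 ((π * (1 / 2) ^ k * r x) ^ 2)) * w x ∂μ
      = ∫⁻ x, (∑ k ∈ Finset.range N, 2 ^ k *
          ENNReal.ofReal (4 * min 1 ((π * (1 / 2) ^ k * r x) ^ 2))) * w x ∂μ := by
        simp_rw [Finset.sum_mul]
        rw [lintegral_finsetSum _ (fun k _ => by fun_prop)]
        refine Finset.sum_congr rfl fun k _ => ?_
        simp_rw [mul_assoc]
        rw [lintegral_const_mul _ (by fun_prop)]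
    _ ≤ ∫⁻ x, (ENNReal.ofReal (16 * π * Real.exp 16) * ∑' j : ℕ, ENNReal.ofReal ((1 / 2) ^ j) *
        ENNReal.ofReal (r x * Real.exp (-4 * π ^ 2 * ((1 / 2) ^ (N + j)) ^ 2 * r x ^ 2))) *
          w x ∂μ := by
        apply lintegral_mono
        intro x
        exact mul_le_mul_left (num_enn (r x) (hr0 x) N) _
    _ = ENNReal.ofReal (16 * π * Real.exp 16) * ∑' j : ℕ, ENNReal.ofReal ((1 / 2) ^ j) *
        ∫⁻ x, ENNReal.ofReal (r x * Real.exp (-4 * π ^ 2 * ((1 / 2) ^ (N + j)) ^ 2 * r x ^ 2)) *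
          w x ∂μ := by
        simp_rw [mul_assoc (ENNReal.ofReal (16 * π * Real.exp 16)), ← ENNReal.tsum_mul_right]
        rw [lintegral_const_mul _ (by fun_prop), lintegral_tsum (fun j => by fun_prop)]
        congr 2; ext j
        simp_rw [mul_assoc (ENNReal.ofReal ((1 / 2) ^ j))]
        rw [lintegral_const_mul _ (by fun_prop)]
    _ ≤ ENNReal.ofReal (16 * π * Real.exp 16) * ∑' j : ℕ, ENNReal.ofReal ((1 / 2) ^ j) *
        (C * (((j : ℝ≥0∞) + 1) * N)) := by
        gcongr with j
        refine (ha (N + j) (by omega)).trans ?_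
        gcongr
        have : N + j ≤ (j + 1) * N := by nlinarith
        exact_mod_cast this
    _ = _ := by
        simp_rw [← ENNReal.tsum_mul_left, ← ENNReal.tsum_mul_right]
        congr 1; ext j; ring

theorem exists_small (d : ℕ → ℝ≥0∞) (B : ℝ≥0∞) (hB : B ≠ ⊤) (K : ℕ)
    (h : ∀ N : ℕ, K ≤ N → 1 ≤ N → ∑ k ∈ Finset.range N, d k ≤ B * N) (k0 : ℕ) :
    ∃ k, k0 ≤ k ∧ d k ≤ 2 * B + 1 := by
  by_contra! hc
  set L := k0 + K + 1
  have h1 := h (2 * L) (by omega) (by omega)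
  have h2 : (L : ℝ≥0∞) * (2 * B + 1) ≤ ∑ k ∈ Finset.range (2 * L), d k := by
    calc (L : ℝ≥0∞) * (2 * B + 1) = ∑ k ∈ Finset.Ico L (2 * L), (2 * B + 1) := by
          rw [Finset.sum_const, Nat.card_Ico, nsmul_eq_mul]; congr 2; omega
      _ ≤ ∑ k ∈ Finset.Ico L (2 * L), d k :=
          Finset.sum_le_sum fun k hk => (hc k (by rw [Finset.mem_Ico] at hk; omega)).le
      _ ≤ _ := Finset.sum_le_sum_of_subset (fun k hk => by
          rw [Finset.mem_Ico] at hk; rw [Finset.mem_range]; omega)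
  have h3 := h2.trans h1
  lift B to NNReal using hB
  have h4 : (L : ℝ) * (2 * B + 1) ≤ B * (2 * L : ℕ) := by exact_mod_cast h3
  have hL : (0:ℝ) < L := by simp [L]; positivity
  push_cast at h4
  nlinarith

theorem quot_bound {n : ℕ} {E : Set (EuclideanSpace ℝ (Fin n))} (hE : MeasurableSet E)
    (hEvol : volume E < ⊤) (ψ : EuclideanSpace ℝ (Fin n) → ℝ) (hc : Continuous ψ)
    (hs : HasCompactSupport ψ) (hb : ∀ x, |ψ x| ≤ 1) (v : EuclideanSpace ℝ (Fin n)) :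
    ENNReal.ofReal (∫ x in E, (ψ (x + v) - ψ x)) ≤
      ∫⁻ x, ‖indC E (x + -v) - indC E x‖ₑ ^ 2 := by
  let F : EuclideanSpace ℝ (Fin n) → ℝ := E.indicator fun _ => (1 : ℝ)
  have hFm : Measurable F := measurable_const.indicator hE
  have hFb : ∀ x, ‖F x‖ ≤ 1 := fun x => by
    by_cases h : x ∈ E <;> simp [F, h]
  have hψ : Integrable ψ := hc.integrable_of_hasCompactSupport hs
  have hψv : Integrable (fun x => ψ (x + v)) := hψ.comp_add_right v
  have i1 : Integrable (fun x => F x * ψ (x + v)) :=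
    hψv.bdd_mul (c := 1) hFm.aestronglyMeasurable (Eventually.of_forall hFb)
  have i2 : Integrable (fun x => F x * ψ x) :=
    hψ.bdd_mul (c := 1) hFm.aestronglyMeasurable (Eventually.of_forall hFb)
  have i3 : Integrable (fun x => F (x + -v) * ψ x) :=
    hψ.bdd_mul (c := 1) (hFm.comp (measurable_add_const _)).aestronglyMeasurable
      (Eventually.of_forall fun x => hFb _)
  have e1 : ∫ x in E, (ψ (x + v) - ψ x) = ∫ x, (F (x + -v) - F x) * ψ x := by
    rw [← integral_indicator hE]
    have : (E.indicator fun x => ψ (x + v) - ψ x) = fun x => F x * ψ (x + v) - F x * ψ x := by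
      ext x; by_cases h : x ∈ E <;> simp [F, h]
    rw [this, integral_sub i1 i2]
    have : ∫ x, F x * ψ (x + v) = ∫ x, F (x + -v) * ψ x := by
      rw [← integral_add_right_eq_self (fun x => F (x + -v) * ψ x) v]
      simp
    rw [this, ← integral_sub i3 i2]
    congr 1; ext x; ring
  rw [e1]
  calc ENNReal.ofReal (∫ x, (F (x + -v) - F x) * ψ x)
      ≤ ENNReal.ofReal ‖∫ x, (F (x + -v) - F x) * ψ x‖ :=
        ENNReal.ofReal_le_ofReal (le_abs_self _)
    _ = ‖∫ x, (F (x + -v) - F x) * ψ x‖ₑ := ofReal_norm _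
    _ ≤ ∫⁻ x, ‖(F (x + -v) - F x) * ψ x‖ₑ := enorm_integral_le_lintegral_enorm _
    _ ≤ _ := by
      apply lintegral_mono
      intro x
      simp only
      rw [← ofReal_norm, ← ofReal_norm, ← ENNReal.ofReal_pow (norm_nonneg _)]
      apply ENNReal.ofReal_le_ofReal
      rw [norm_mul, Real.norm_eq_abs (ψ x)]
      have hbx := hb x
      by_cases h1 : x + -v ∈ E <;> by_cases h2 : x ∈ E <;> simp [F, indC, h1, h2, hbx]

theorem div_part {n : ℕ} {E : Set (EuclideanSpace ℝ (Fin n))} (hE : MeasurableSet E)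
    (hEvol : volume E < ⊤) (ψ : EuclideanSpace ℝ (Fin n) → ℝ) (hc : ContDiff ℝ 1 ψ)
    (hs : HasCompactSupport ψ) (hb : ∀ x, |ψ x| ≤ 1) (v : EuclideanSpace ℝ (Fin n)) (M : ℝ≥0∞)
    (h : ∀ k0 : ℕ, ∃ k, k0 ≤ k ∧
      2 ^ k * ∫⁻ x, ‖indC E (x + -(((1:ℝ) / 2) ^ k • v)) - indC E x‖ₑ ^ 2 ≤ M) :
    ENNReal.ofReal (∫ x in E, fderiv ℝ ψ x v) ≤ M := by
  obtain ⟨L, hL⟩ := hc.lipschitzWith_of_hasCompactSupport hs (by norm_num)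
  have ht : Tendsto (fun k : ℕ => ∫ x in E, (2:ℝ) ^ k * (ψ (x + ((1:ℝ) / 2) ^ k • v) - ψ x)) atTop
      (𝓝 (∫ x in E, fderiv ℝ ψ x v)) := by
    have : IsFiniteMeasure (volume.restrict E) := ⟨by simpa using hEvol⟩
    apply tendsto_integral_of_dominated_convergence (fun _ => (L : ℝ) * ‖v‖)
    · intro k
      have := hc.continuous
      exact Continuous.aestronglyMeasurable (by fun_prop)
    · exact integrable_const _
    · intro k
      refine Eventually.of_forall fun x => ?_
      have := hL.dist_le_mul (x + ((1:ℝ) / 2) ^ k • v) x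
      rw [dist_eq_norm, dist_eq_norm, add_sub_cancel_left, norm_smul, norm_pow] at this
      rw [norm_mul, norm_pow]
      norm_num at this ⊢
      calc 2 ^ k * |ψ (x + ((1:ℝ) / 2) ^ k • v) - ψ x| ≤ 2 ^ k * (L * ((1 / 2) ^ k * ‖v‖)) := by
            gcongr
        _ = L * ‖v‖ := by rw [one_div, inv_pow]; field_simp
    · refine Eventually.of_forall fun x => ?_
      have hd : HasFDerivAt ψ (fderiv ℝ ψ x) x := (hc.differentiable (by norm_num) x).hasFDerivAt
      have := hd.lim v (c := fun k : ℕ => (2:ℝ) ^ k) (l := atTop)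
        (by
          simp only [norm_pow, Real.norm_ofNat]
          exact tendsto_pow_atTop_atTop_of_one_lt (by norm_num))
      simpa using this
  refine le_of_tendsto_of_frequently (ENNReal.tendsto_ofReal ht) ?_
  rw [frequently_atTop]
  intro k0
  obtain ⟨k, hk, hM⟩ := h k0
  refine ⟨k, hk, le_trans ?_ hM⟩
  rw [integral_const_mul, ENNReal.ofReal_mul (by positivity), ENNReal.ofReal_pow (by norm_num)]
  have := quot_bound hE hEvol ψ hc.continuous hs hb (((1:ℝ) / 2) ^ k • v)
  norm_num at this ⊢
  gcongr

theorem perim_bound {n : ℕ} {E : Set (EuclideanSpace ℝ (Fin n))} (hE : MeasurableSet E)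
    (hEvol : volume E < ⊤) (M : ℝ≥0∞)
    (h : ∀ i : Fin n, ∀ k0 : ℕ, ∃ k, k0 ≤ k ∧
      2 ^ k * ∫⁻ x, ‖indC E (x + -(((1:ℝ) / 2) ^ k • EuclideanSpace.single i (1:ℝ))) -
        indC E x‖ₑ ^ 2 ≤ M) :
    perim E ≤ n * M := by
  unfold perim
  refine iSup_le fun φ => iSup_le fun hc => iSup_le fun hs => iSup_le fun hb => ?_
  have hd : ∀ i x, fderiv ℝ φ x (EuclideanSpace.single i 1) i =
      fderiv ℝ (fun y => φ y i) x (EuclideanSpace.single i 1) := by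
    intro i x
    have h1 : HasFDerivAt φ (fderiv ℝ φ x) x := (hc.differentiable (by norm_num) x).hasFDerivAt
    have h2 := (EuclideanSpace.proj (𝕜 := ℝ) (ι := Fin n) i).hasFDerivAt (x := φ x).comp x h1
    have h3 : fderiv ℝ (fun y => φ y i) x = _ := h2.fderiv
    rw [h3]; rfl
  have hci : ∀ i, ContDiff ℝ 1 (fun y => φ y i) := fun i =>
    (EuclideanSpace.proj (𝕜 := ℝ) (ι := Fin n) i).contDiff.comp hc
  have hsi : ∀ i, HasCompactSupport (fun y => φ y i) := fun i =>
    hs.comp_left (g := fun z : EuclideanSpace ℝ (Fin n) => z i) rfl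
  have hbi : ∀ i x, |φ x i| ≤ 1 := fun i x => (PiLp.norm_apply_le (φ x) i).trans (hb x)
  have hint : ∀ i, Integrable
      (fun x => fderiv ℝ (fun y => φ y i) x (EuclideanSpace.single i 1)) := by
    intro i
    apply Continuous.integrable_of_hasCompactSupport
    · exact ((hci i).continuous_fderiv (by norm_num)).clm_apply continuous_const
    · exact ((hsi i).fderiv (𝕜 := ℝ)).comp_left
        (g := fun A : EuclideanSpace ℝ (Fin n) →L[ℝ] ℝ => A (EuclideanSpace.single i 1)) rfl
  unfold divg
  simp_rw [hd]
  rw [integral_finsetSum _ (fun i _ => (hint i).integrableOn)]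
  have hsub : ∀ (s : Finset (Fin n)) (f : Fin n → ℝ),
      ENNReal.ofReal (∑ i ∈ s, f i) ≤ ∑ i ∈ s, ENNReal.ofReal (f i) := by
    intro s f
    induction s using Finset.cons_induction with
    | empty => simp
    | cons a s ha ih =>
      rw [Finset.sum_cons, Finset.sum_cons]
      exact ENNReal.ofReal_add_le.trans (by gcongr)
  refine (hsub _ _).trans ?_
  refine (Finset.sum_le_sum fun i _ =>
    div_part hE hEvol _ (hci i) (hsi i) (hbi i) (EuclideanSpace.single i 1) M (h i)).trans ?_
  simp

/-- if `E ⊆ ℝⁿ` has finite Lebesgue measure and infinite perimeter then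
`limsup_{ε→0⁺} (1/|log ε|) ‖γ_ε ∗ 1_E‖_{H^{1/2}}² = ∞`. -/
theorem limsup_infinite_of_infinite_perimeter (n : ℕ) (hn : 1 ≤ n)
    (E : Set (EuclideanSpace ℝ (Fin n))) (hE : MeasurableSet E)
    (hEvol : volume E < ⊤) (hper : perim E = ⊤) :
    Filter.limsup
      (fun ε : ℝ => ENNReal.ofReal |Real.log ε|⁻¹ *
        H12e (conv (gaussSc ε) (E.indicator fun _ => (1 : ℝ))))
      (𝓝[>] (0 : ℝ)) = ⊤ := by
  by_contra hne
  have hlt := lt_top_iff_ne_top.2 hne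
  obtain ⟨C, hC1, hC2⟩ := exists_between hlt
  have hev := eventually_lt_of_limsup_lt hC1
  have htend : Tendsto (fun m : ℕ => ((1:ℝ) / 2) ^ m) atTop (𝓝[>] (0:ℝ)) :=
    tendsto_pow_atTop_nhdsWithin_zero_of_lt_one (by norm_num) (by norm_num)
  have hev2 := htend.eventually hev
  obtain ⟨K, hK⟩ := eventually_atTop.1 hev2
  have hcont : Continuous (𝓕 (indC E)) :=
    VectorFourier.fourierIntegral_continuous Real.continuous_fourierChar
      (by exact continuous_inner) (integrable_indC hE hEvol)
  have ha : ∀ m : ℕ, K + 1 ≤ m → ∫⁻ ξ : EuclideanSpace ℝ (Fin n),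
      ENNReal.ofReal (‖ξ‖ * Real.exp (-4 * π ^ 2 * ((1 / 2) ^ m) ^ 2 * ‖ξ‖ ^ 2)) *
        ‖𝓕 (indC E) ξ‖ₑ ^ 2 ≤ C * m := by
    intro m hm
    have h1 := (hK m (by omega)).le
    rw [H12e_eq hE hEvol (by positivity)] at h1
    set A := ∫⁻ ξ : EuclideanSpace ℝ (Fin n),
      ENNReal.ofReal (‖ξ‖ * Real.exp (-4 * π ^ 2 * ((1 / 2) ^ m) ^ 2 * ‖ξ‖ ^ 2)) *
        ‖𝓕 (indC E) ξ‖ₑ ^ 2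
    have hm0 : (0:ℝ) < m := by exact_mod_cast (by omega : 0 < m)
    have hl2 : 0 < Real.log 2 := Real.log_pos (by norm_num)
    have hlog : |Real.log ((1 / 2) ^ m)| = m * Real.log 2 := by
      rw [Real.log_pow, one_div, Real.log_inv, mul_neg, abs_neg, abs_of_pos (by positivity)]
    have hl1 : Real.log 2 ≤ 1 := by have := Real.log_two_lt_d9; linarith
    rw [hlog] at h1
    calc A = ENNReal.ofReal (m * Real.log 2) * (ENNReal.ofReal (m * Real.log 2)⁻¹ * A) := by
          rw [← mul_assoc, ← ENNReal.ofReal_mul (by positivity),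
            mul_inv_cancel₀ (by positivity), ENNReal.ofReal_one, one_mul]
      _ ≤ ENNReal.ofReal m * C := by
          gcongr
          nlinarith
      _ = C * m := by rw [ENNReal.ofReal_natCast, mul_comm]
  obtain ⟨B, hB, hsum⟩ := sum_bound (volume : Measure (EuclideanSpace ℝ (Fin n)))
    (fun ξ => ‖ξ‖) measurable_norm (fun _ => norm_nonneg _) (fun ξ => ‖𝓕 (indC E) ξ‖ₑ ^ 2)
    (hcont.measurable.enorm.pow_const 2) C hC2.ne (K + 1) ha
  have hfin := perim_bound hE hEvol (2 * B + 1) (fun i k0 => by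
    obtain ⟨k, hk, hle⟩ := exists_small _ B hB (K + 1) hsum k0
    refine ⟨k, hk, le_trans ?_ hle⟩
    refine mul_le_mul_right ?_ _
    refine (diff_bound hE hEvol _).trans_eq ?_
    congr 1; ext ξ
    have : ‖-(((1:ℝ) / 2) ^ k • EuclideanSpace.single i (1:ℝ))‖ = (1 / 2) ^ k := by
      rw [norm_neg, norm_smul, norm_pow]; simp
    rw [this])
  rw [hper] at hfin
  exact absurd (top_le_iff.1 hfin)
    (ENNReal.mul_ne_top (ENNReal.natCast_ne_top n) (by finiteness))
end
end

section
/- Let f be a smooth function on R^n with ∫ f = 0 and ∫ |x| |f(x)| dx < ∞, and let u ∈ BV(R^n) ∩ L^∞(R^n). For every ε > 0 there exists δ > 0 such that for every v ∈ BV(R^n) ∩ L^∞(R^n) with limsup_{r→0⁺} (1/r) ‖f_r ∗ v‖_{L^2}^2 < δ, one has limsup_{r→0⁺} (1/r) | ‖f_r ∗ (u+v)‖_{L^2}^2 − ‖f_r ∗ u‖_{L^2}^2 | < ε. -/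
open MeasureTheory Filter Topology Real
open scoped FourierTransform RealInnerProductSpace ENNReal

noncomputable section

variable {V : Type*} [NormedAddCommGroup V] [InnerProductSpace ℝ V]
  [FiniteDimensional ℝ V] [MeasurableSpace V] [BorelSpace V] [MeasureSpace V]

/-- `μ` is the total variation measure `|Du|` of the distributional derivative of `u`:
on every open set it is given by the classical sup over vector fields. -/
def IsVarMeasure {n : ℕ} (u : EuclideanSpace ℝ (Fin n) → ℝ)
    (μ : Measure (EuclideanSpace ℝ (Fin n))) : Prop :=
  ∀ U : Set (EuclideanSpace ℝ (Fin n)), IsOpen U →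
    μ U = ⨆ (φ : EuclideanSpace ℝ (Fin n) → EuclideanSpace ℝ (Fin n))
      (_ : ContDiff ℝ 1 φ) (_ : HasCompactSupport φ) (_ : tsupport φ ⊆ U)
      (_ : ∀ x, ‖φ x‖ ≤ 1),
      ENNReal.ofReal (∫ x, u x * divg φ x)


open ContinuousLinearMap Convolution in
lemma lip_aux {n : ℕ} (u : EuclideanSpace ℝ (Fin n) → ℝ) (M : ℝ) (hu : Measurable u)
    (hM : ∀ x, |u x| ≤ M) (K : ℝ) (hK0 : 0 ≤ K)
    (hK : ∀ φ : EuclideanSpace ℝ (Fin n) → EuclideanSpace ℝ (Fin n), ContDiff ℝ 1 φ →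
      HasCompactSupport φ → (∀ x, ‖φ x‖ ≤ 1) → ∫ x, u x * divg φ x ≤ K)
    (g : EuclideanSpace ℝ (Fin n) → ℝ) (hg : ContDiff ℝ 1 g) (hgc : HasCompactSupport g)
    (hg1 : ∀ x, |g x| ≤ 1) (z z' : EuclideanSpace ℝ (Fin n)) :
    |(∫ x, u x * g (z - x)) - ∫ x, u x * g (z' - x)| ≤ K * ‖z - z'‖ := by
  have hloc : LocallyIntegrable u volume := by
    refine (locallyIntegrable_const M).mono hu.aestronglyMeasurable ?_
    filter_upwards with x
    exact (hM x).trans (le_abs_self M)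
  have hd := fun x₀ => hgc.hasFDerivAt_convolution_right (lsmul ℝ ℝ) hloc hg x₀
  have hb : ∀ x₀, ‖(u ⋆[(lsmul ℝ ℝ).precompR (EuclideanSpace ℝ (Fin n)), volume] fderiv ℝ g) x₀‖ ≤ K := by
    intro x₀
    have key : ∀ e : EuclideanSpace ℝ (Fin n), ‖e‖ = 1 →
        (u ⋆[(lsmul ℝ ℝ).precompR (EuclideanSpace ℝ (Fin n)), volume] fderiv ℝ g) x₀ e ≤ K := by
      intro e he
      rw [convolution_precompR_apply _ hloc (hgc.fderiv ℝ) (hg.continuous_fderiv one_ne_zero)]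
      have hgd : Differentiable ℝ g := hg.differentiable one_ne_zero
      have hgx : ContDiff ℝ 1 (fun x => - g (x₀ - x)) := by fun_prop
      have := hK (fun x => (- g (x₀ - x)) • e) (by fun_prop) ?_ ?_
      · convert this using 1
        rw [convolution_def]
        refine integral_congr_ae (Eventually.of_forall fun x => ?_)
        simp only [lsmul_apply, smul_eq_mul]
        congr 1
        have h1 : HasFDerivAt (fun x => - g (x₀ - x)) (fderiv ℝ g (x₀ - x)) x := by
          have := ((hgd (x₀ - x)).hasFDerivAt.comp x ((hasFDerivAt_id x).const_sub x₀)).neg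
          have e' : -((fderiv ℝ g (x₀ - x)).comp
              (-ContinuousLinearMap.id ℝ (EuclideanSpace ℝ (Fin n)))) = fderiv ℝ g (x₀ - x) := by
            ext; simp
          rw [← e']
          exact this
        have h2 := h1.smul_const e
        unfold divg
        rw [h2.fderiv]
        simp only [smulRight_apply, PiLp.smul_apply, smul_eq_mul]
        conv_lhs => rw [← (EuclideanSpace.basisFun (Fin n) ℝ).sum_repr e]
        simp [map_sum, mul_comm]
      · have h0 : HasCompactSupport (fun x => g (x₀ - x)) :=
          hgc.comp_homeomorph (Homeomorph.subLeft x₀)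
        refine h0.mono ?_
        intro x hx
        simp only [Function.mem_support] at hx ⊢
        intro h
        simp [h] at hx
      · intro x
        rw [norm_smul, he, mul_one, norm_neg]
        exact hg1 _
    refine opNorm_le_of_unit_norm hK0 fun e he => ?_
    rw [Real.norm_eq_abs, abs_le]
    refine ⟨?_, key e he⟩
    have := key (-e) (by simpa using he)
    rw [map_neg] at this
    linarith
  exact Convex.norm_image_sub_le_of_norm_hasFDerivWithin_le
    (fun x _ => (hd x).hasFDerivWithinAt) (fun x _ => hb x) convex_univ
    (Set.mem_univ z') (Set.mem_univ z)

open ContinuousLinearMap Convolution in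
lemma dual_aux {n : ℕ} (w : EuclideanSpace ℝ (Fin n) → ℝ) (M : ℝ) (hw : Measurable w)
    (hM : ∀ x, |w x| ≤ M) (K : ℝ)
    (hK : ∀ g : EuclideanSpace ℝ (Fin n) → ℝ, ContDiff ℝ 1 g →
      HasCompactSupport g → (∀ x, |g x| ≤ 1) → ∫ x, w x * g x ≤ K) :
    ∫⁻ x, ‖w x‖ₑ ≤ ENNReal.ofReal K := by
  have hM0 : 0 ≤ M := (abs_nonneg _).trans (hM 0)
  have hR : ∀ R : ℕ, ∫⁻ x in Metric.ball (0 : EuclideanSpace ℝ (Fin n)) R, ‖w x‖ₑ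
      ≤ ENNReal.ofReal K := by
    intro R
    set B := Metric.ball (0 : EuclideanSpace ℝ (Fin n)) (R : ℝ) with hB
    set σ : EuclideanSpace ℝ (Fin n) → ℝ := B.indicator (fun x => SignType.sign (w x)) with hσ
    have hs1 : ∀ a : ℝ, |((SignType.sign a : SignType) : ℝ)| ≤ 1 := by
      intro a
      rcases lt_trichotomy a 0 with h | h | h <;> simp [h]
    have hsm : Measurable (fun x => ((SignType.sign (w x) : SignType) : ℝ)) := by
      have : (fun x => ((SignType.sign (w x) : SignType) : ℝ)) =
          fun x => if 0 < w x then (1:ℝ) else if w x < 0 then -1 else 0 := by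
        ext x
        rcases lt_trichotomy (w x) 0 with h | h | h <;> simp [h, not_lt.2 h.le]
      rw [this]
      exact Measurable.ite (measurableSet_lt measurable_const hw) measurable_const
        (Measurable.ite (measurableSet_lt hw measurable_const) measurable_const measurable_const)
    have hσm : Measurable σ := hsm.indicator measurableSet_ball
    have hσ1 : ∀ x, |σ x| ≤ 1 := by
      intro x
      by_cases hx : x ∈ B
      · simp only [hσ, Set.indicator_of_mem hx]; exact hs1 _
      · simp [hσ, Set.indicator_of_notMem hx]
    have hloc : LocallyIntegrable σ volume := by
      refine (locallyIntegrable_const (1:ℝ)).mono hσm.aestronglyMeasurable ?_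
      filter_upwards with x
      simpa using hσ1 x
    have hσsupp : ∀ x, σ x ≠ 0 → x ∈ B := fun x hx => by
      by_contra h
      exact hx (Set.indicator_of_notMem h _)
    have hσc : HasCompactSupport σ := by
      refine HasCompactSupport.of_support_subset_isCompact
        (isCompact_closedBall (0 : EuclideanSpace ℝ (Fin n)) (R : ℝ)) ?_
      intro x hx
      exact Metric.ball_subset_closedBall (hσsupp x hx)
    let φ : ℕ → ContDiffBump (0 : EuclideanSpace ℝ (Fin n)) := fun k =>
      { rIn := 1 / ((k:ℝ) + 1) / 2, rOut := 1 / ((k:ℝ) + 1), rIn_pos := by positivity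
        rIn_lt_rOut := half_lt_self (by positivity) }
    have hφ1 : ∀ k, (φ k).rOut ≤ 1 := fun k => by
      change 1 / ((k:ℝ) + 1) ≤ 1
      rw [div_le_one (by positivity)]
      have : (0:ℝ) ≤ k := by positivity
      linarith
    have hae := ContDiffBump.ae_convolution_tendsto_right_of_locallyIntegrable (φ := φ) (l := atTop)
      (K := 2) (μ := volume) (g := σ) (tendsto_one_div_add_atTop_nhds_zero_nat)
      (Eventually.of_forall fun k => by
        change 1 / ((k:ℝ) + 1) ≤ 2 * (1 / ((k:ℝ) + 1) / 2); linarith) hloc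
    set ψ : ℕ → EuclideanSpace ℝ (Fin n) → ℝ := fun k =>
      (φ k).normed volume ⋆[lsmul ℝ ℝ, volume] σ with hψ
    have hψsm : ∀ k, ContDiff ℝ 1 (ψ k) := fun k =>
      (φ k).hasCompactSupport_normed.contDiff_convolution_left _
        ((φ k).contDiff_normed (n := 1)) hloc
    have hψc : ∀ k, HasCompactSupport (ψ k) := fun k =>
      (φ k).hasCompactSupport_normed.convolution _ hσc
    have hψ1 : ∀ k x, |ψ k x| ≤ 1 := by
      intro k x
      have := dist_convolution_le (μ := volume) (x₀ := x) (z₀ := (0:ℝ)) (g := σ) zero_le_one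
        (φ k).support_normed_eq.subset
        (fun x => (φ k).nonneg_normed x) (φ k).integral_normed hσm.aestronglyMeasurable
        (fun x _ => by simpa using hσ1 x)
      simpa using this
    have hψs : ∀ k x, ψ k x ≠ 0 → x ∈ Metric.closedBall (0 : EuclideanSpace ℝ (Fin n)) (R + 1) := by
      intro k x hx
      have := support_convolution_subset (lsmul ℝ ℝ) (μ := volume) (f := (φ k).normed volume)
        (g := σ) hx
      obtain ⟨a, ha, b, hb, rfl⟩ := this
      rw [(φ k).support_normed_eq] at ha
      have hb' := hσsupp b hb
      simp only [hB, Metric.mem_ball, dist_zero_right, Metric.mem_closedBall] at *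
      have := norm_add_le a b
      have := hφ1 k
      linarith
    have hlim : Tendsto (fun k => ∫ x, w x * ψ k x) atTop (𝓝 (∫ x, w x * σ x)) := by
      refine tendsto_integral_of_dominated_convergence
        (fun x => (Metric.closedBall (0 : EuclideanSpace ℝ (Fin n)) (R + 1)).indicator
          (fun _ => M) x) ?_ ?_ ?_ ?_
      · exact fun k => (hw.mul (hψsm k).continuous.measurable).aestronglyMeasurable
      · rw [integrable_indicator_iff measurableSet_closedBall]
        exact integrableOn_const (measure_closedBall_lt_top.ne)
      · intro k
        filter_upwards with x
        by_cases hx : ψ k x = 0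
        · rw [hx]
          simp only [mul_zero, norm_zero]
          exact Set.indicator_nonneg (fun _ _ => hM0) _
        · rw [Set.indicator_of_mem (hψs k x hx), norm_mul]
          calc ‖w x‖ * ‖ψ k x‖ ≤ M * 1 :=
                mul_le_mul (hM x) (hψ1 k x) (norm_nonneg _) hM0
            _ = M := mul_one M
      · filter_upwards [hae] with x hx
        exact hx.const_mul _
    have hle : ∫ x, w x * σ x ≤ K :=
      le_of_tendsto' hlim fun k => hK _ (hψsm k) (hψc k) (hψ1 k)
    have heq : (fun x => w x * σ x) = B.indicator (fun x => ‖w x‖) := by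
      ext x
      by_cases hx : x ∈ B
      · simp only [hσ, Set.indicator_of_mem hx]
        rw [Real.norm_eq_abs]
        exact self_mul_sign _
      · simp [hσ, Set.indicator_of_notMem hx]
    rw [heq, integral_indicator measurableSet_ball] at hle
    have hint : IntegrableOn w B := by
      refine Integrable.mono' (g := fun _ => M) (integrableOn_const measure_ball_lt_top.ne)
        hw.aestronglyMeasurable ?_
      filter_upwards with x using hM x
    rw [← ofReal_integral_norm_eq_lintegral_enorm hint]
    exact ENNReal.ofReal_le_ofReal hle
  have hU : (⋃ R : ℕ, Metric.ball (0 : EuclideanSpace ℝ (Fin n)) (R:ℝ)) = Set.univ :=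
    Metric.iUnion_ball_nat 0
  rw [← setLIntegral_univ, ← hU, setLIntegral_iUnion_of_directed]
  · exact iSup_le hR
  · refine Monotone.directed_le ?_
    intro a b hab
    exact Metric.ball_subset_ball (by exact_mod_cast hab)

lemma trans_aux {n : ℕ} (u : EuclideanSpace ℝ (Fin n) → ℝ) (M : ℝ) (hu : Measurable u)
    (hM : ∀ x, |u x| ≤ M) (K : ℝ) (hK0 : 0 ≤ K)
    (hK : ∀ φ : EuclideanSpace ℝ (Fin n) → EuclideanSpace ℝ (Fin n), ContDiff ℝ 1 φ →
      HasCompactSupport φ → (∀ x, ‖φ x‖ ≤ 1) → ∫ x, u x * divg φ x ≤ K)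
    (y : EuclideanSpace ℝ (Fin n)) :
    ∫⁻ x, ‖u (x - y) - u x‖ₑ ≤ ENNReal.ofReal (K * ‖y‖) := by
  refine dual_aux (fun x => u (x - y) - u x) (2 * M) (by fun_prop) ?_ _ ?_
  · intro x
    have := abs_sub (u (x - y)) (u x)
    have := hM x
    have := hM (x - y)
    linarith
  · intro g hg hgc hg1
    have hgi : Integrable g := hg.continuous.integrable_of_hasCompactSupport hgc
    have i1 : Integrable fun x => u x * g x :=
      hgi.bdd_mul hu.aestronglyMeasurable (Eventually.of_forall hM)
    have i2 : Integrable fun x => u (x - y) * g x :=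
      hgi.bdd_mul (c := M) (hu.comp (measurable_id.sub_const y)).aestronglyMeasurable (Eventually.of_forall fun x => hM _)
    have h := lip_aux u M hu hM K hK0 hK (fun x => g (-x)) (by fun_prop)
      (hgc.comp_homeomorph (Homeomorph.neg _)) (fun x => hg1 _) (-y) 0
    have e1 : ∫ x, u (x - y) * g x = ∫ x, u x * g (x + y) := by
      rw [← integral_add_right_eq_self _ y]
      simp
    simp only [sub_mul]
    rw [integral_sub i2 i1, e1]
    refine (le_abs_self _).trans ?_
    simpa [add_comm] using h

lemma trunc_aux {n : ℕ} (u : EuclideanSpace ℝ (Fin n) → ℝ) (hu : Measurable u)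
    (hub : eLpNorm u ⊤ volume < ⊤) :
    ∃ (u' : EuclideanSpace ℝ (Fin n) → ℝ) (M : ℝ), Measurable u' ∧ (∀ x, |u' x| ≤ M) ∧
      u =ᵐ[volume] u' := by
  obtain ⟨M, hM0, hM⟩ : ∃ M : ℝ, 0 ≤ M ∧ ∀ᵐ x, |u x| ≤ M := by
    refine ⟨(eLpNorm u ⊤ volume).toReal, ENNReal.toReal_nonneg, ?_⟩
    rw [eLpNorm_exponent_top] at *
    filter_upwards [ae_le_eLpNormEssSup (f := u) (μ := volume)] with x hx
    have := ENNReal.toReal_mono hub.ne hx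
    simpa using this
  refine ⟨fun x => max (-M) (min M (u x)), M, by fun_prop, ?_, ?_⟩
  · intro x
    rw [abs_le]
    exact ⟨le_max_left _ _, max_le (by linarith) (min_le_left _ _)⟩
  · filter_upwards [hM] with x hx
    rw [abs_le] at hx
    rw [min_eq_right hx.2, max_eq_right hx.1]

lemma conv_congr_aux {n : ℕ} (g u u' : EuclideanSpace ℝ (Fin n) → ℝ) (h : u =ᵐ[volume] u')
    (x : EuclideanSpace ℝ (Fin n)) : conv g u x = conv g u' x := by
  unfold conv
  refine integral_congr_ae ?_
  have := (quasiMeasurePreserving_sub_left volume x).ae_eq h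
  filter_upwards [this] with y hy
  simp only [Function.comp] at hy
  rw [hy]

lemma conv_scale_aux {n : ℕ} (f u : EuclideanSpace ℝ (Fin n) → ℝ) {r : ℝ} (hr : 0 < r)
    (x : EuclideanSpace ℝ (Fin n)) :
    conv (scaleFn f r) u x = ∫ y, f y * u (x - r • y) := by
  unfold conv scaleFn
  have := Measure.integral_comp_inv_smul (volume : Measure (EuclideanSpace ℝ (Fin n)))
    (fun y => f y * u (x - r • y)) r
  simp only [smul_inv_smul₀ hr.ne'] at this
  simp only [mul_assoc]
  rw [integral_const_mul, this, abs_of_pos (by positivity), smul_eq_mul, ← mul_assoc, inv_pow,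
    inv_mul_cancel₀ (by positivity), one_mul]

lemma int_aux {n : ℕ} (f u : EuclideanSpace ℝ (Fin n) → ℝ) (hfi : Integrable f)
    (hu : Measurable u) (M : ℝ) (hM : ∀ x, |u x| ≤ M) (r : ℝ) (x : EuclideanSpace ℝ (Fin n)) :
    Integrable fun y => f y * u (x - r • y) :=
  hfi.mul_bdd (c := M) (Measurable.aestronglyMeasurable (by fun_prop))
    (Eventually.of_forall fun y => hM _)

lemma conv_meas_aux {n : ℕ} (f u : EuclideanSpace ℝ (Fin n) → ℝ) (hf : Continuous f)
    (hu : Measurable u) {r : ℝ} (hr : 0 < r) : Measurable (conv (scaleFn f r) u) := by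
  have : conv (scaleFn f r) u = fun x => ∫ y, f y * u (x - r • y) :=
    funext fun x => conv_scale_aux f u hr x
  rw [this]
  have hf' := hf.measurable
  have h : StronglyMeasurable (Function.uncurry fun x y : EuclideanSpace ℝ (Fin n) =>
      f y * u (x - r • y)) := by
    apply Measurable.stronglyMeasurable
    unfold Function.uncurry
    fun_prop
  exact h.integral_prod_right.measurable

lemma bound_aux {n : ℕ} (f u : EuclideanSpace ℝ (Fin n) → ℝ) (hf : Continuous f)
    (hfi : Integrable f) (hf0 : (∫ x, f x) = 0) (hfd : Integrable fun x => ‖x‖ * |f x|)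
    (M : ℝ) (hu : Measurable u) (hM : ∀ x, |u x| ≤ M) (K : ℝ) (hK0 : 0 ≤ K)
    (hK : ∀ φ : EuclideanSpace ℝ (Fin n) → EuclideanSpace ℝ (Fin n), ContDiff ℝ 1 φ →
      HasCompactSupport φ → (∀ x, ‖φ x‖ ≤ 1) → ∫ x, u x * divg φ x ≤ K)
    {r : ℝ} (hr : 0 < r) :
    ∫⁻ x, (‖conv (scaleFn f r) u x‖₊ : ℝ≥0∞) ^ 2 ≤
      ENNReal.ofReal r * ENNReal.ofReal (((∫ x, |f x|) * M) * (K * ∫ x, ‖x‖ * |f x|)) := by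
  have hM0 : 0 ≤ M := (abs_nonneg _).trans (hM 0)
  have hf' := hf.measurable
  have hsup : ∀ x, ‖conv (scaleFn f r) u x‖ₑ ≤ ENNReal.ofReal ((∫ x, |f x|) * M) := by
    intro x
    rw [conv_scale_aux f u hr, ← ofReal_norm_eq_enorm]
    refine ENNReal.ofReal_le_ofReal ?_
    rw [← integral_mul_const]
    refine norm_integral_le_of_norm_le (hfi.abs.mul_const M) (Eventually.of_forall fun y => ?_)
    rw [norm_mul]
    exact mul_le_mul_of_nonneg_left (hM _) (norm_nonneg _)
  have hL1 : ∫⁻ x, ‖conv (scaleFn f r) u x‖ₑ ≤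
      ENNReal.ofReal (r * (K * ∫ x, ‖x‖ * |f x|)) := by
    calc ∫⁻ x, ‖conv (scaleFn f r) u x‖ₑ
        ≤ ∫⁻ x, ∫⁻ y, ‖f y‖ₑ * ‖u (x - r • y) - u x‖ₑ := by
          refine lintegral_mono fun x => ?_
          have : conv (scaleFn f r) u x = ∫ y, f y * (u (x - r • y) - u x) := by
            simp only [mul_sub]
            rw [integral_sub (int_aux f u hfi hu M hM r x) (hfi.mul_const _), integral_mul_const,
              hf0, zero_mul, sub_zero, conv_scale_aux f u hr]
          rw [this]
          refine (enorm_integral_le_lintegral_enorm _).trans (le_of_eq ?_)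
          simp only [enorm_mul]
      _ = ∫⁻ y, ∫⁻ x, ‖f y‖ₑ * ‖u (x - r • y) - u x‖ₑ := by
          refine lintegral_lintegral_swap (Measurable.aemeasurable ?_)
          unfold Function.uncurry
          fun_prop
      _ ≤ ∫⁻ y, ENNReal.ofReal (r * K * (‖y‖ * |f y|)) := by
          refine lintegral_mono fun y => ?_
          rw [lintegral_const_mul _ (by fun_prop)]
          calc ‖f y‖ₑ * ∫⁻ x, ‖u (x - r • y) - u x‖ₑ
              ≤ ‖f y‖ₑ * ENNReal.ofReal (K * ‖r • y‖) := by
                gcongr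
                exact trans_aux u M hu hM K hK0 hK _
            _ = _ := by
                rw [← ofReal_norm_eq_enorm, ← ENNReal.ofReal_mul (norm_nonneg _), norm_smul,
                  Real.norm_of_nonneg hr.le, Real.norm_eq_abs]
                congr 1
                ring
      _ = ENNReal.ofReal (∫ y, r * K * (‖y‖ * |f y|)) := by
          rw [ofReal_integral_eq_lintegral_ofReal (hfd.const_mul _)]
          exact Eventually.of_forall fun y => by positivity
      _ = _ := by rw [integral_const_mul, mul_assoc]
  have hF : 0 ≤ (∫ x, |f x|) * M := mul_nonneg (integral_nonneg fun x => abs_nonneg _) hM0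
  calc ∫⁻ x, (‖conv (scaleFn f r) u x‖₊ : ℝ≥0∞) ^ 2
      ≤ ∫⁻ x, ENNReal.ofReal ((∫ x, |f x|) * M) * ‖conv (scaleFn f r) u x‖ₑ := by
        refine lintegral_mono fun x => ?_
        rw [sq]
        exact mul_le_mul_left (hsup x) _
    _ = ENNReal.ofReal ((∫ x, |f x|) * M) * ∫⁻ x, ‖conv (scaleFn f r) u x‖ₑ :=
        lintegral_const_mul _ (conv_meas_aux f u hf hu hr).enorm
    _ ≤ ENNReal.ofReal ((∫ x, |f x|) * M) * ENNReal.ofReal (r * (K * ∫ x, ‖x‖ * |f x|)) := by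
        gcongr
    _ = _ := by
        rw [← ENNReal.ofReal_mul hF, ← ENNReal.ofReal_mul hr.le]
        congr 1
        ring

lemma pt_aux (a b t : ℝ) (ht : 0 < t) :
    (‖a + b‖₊ : ℝ≥0∞) ^ 2 ≤ (ENNReal.ofReal t * (‖a‖₊ : ℝ≥0∞) ^ 2
      + ENNReal.ofReal (1 + 1 / t) * (‖b‖₊ : ℝ≥0∞) ^ 2) + (‖a‖₊ : ℝ≥0∞) ^ 2 ∧
    (‖a‖₊ : ℝ≥0∞) ^ 2 ≤ (ENNReal.ofReal t * (‖a‖₊ : ℝ≥0∞) ^ 2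
      + ENNReal.ofReal (1 + 1 / t) * (‖b‖₊ : ℝ≥0∞) ^ 2) + (‖a + b‖₊ : ℝ≥0∞) ^ 2 := by
  have e : ∀ c : ℝ, (‖c‖₊ : ℝ≥0∞) ^ 2 = ENNReal.ofReal (c ^ 2) := by
    intro c
    rw [← sq_abs, ENNReal.ofReal_pow (abs_nonneg c), ← Real.norm_eq_abs, ofReal_norm_eq_enorm]
    rfl
  have h1 : 0 ≤ t * (a - b / t) ^ 2 := by positivity
  have h2 : 0 ≤ t * (a + b / t) ^ 2 := by positivity
  have e1 : t * (a - b / t) ^ 2 = t * a ^ 2 + 1 / t * b ^ 2 - 2 * (a * b) := by field_simp; ring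
  have e2 : t * (a + b / t) ^ 2 = t * a ^ 2 + 1 / t * b ^ 2 + 2 * (a * b) := by field_simp; ring
  simp only [e]
  rw [← ENNReal.ofReal_mul ht.le, ← ENNReal.ofReal_mul (by positivity),
    ← ENNReal.ofReal_add (by positivity) (by positivity),
    ← ENNReal.ofReal_add (by positivity) (by positivity),
    ← ENNReal.ofReal_add (by positivity) (by positivity)]
  constructor <;> refine ENNReal.ofReal_le_ofReal ?_ <;> nlinarith [sq_nonneg b]

/-- continuity under perturbations: if `limsup (1/r)‖f_r ∗ v‖_{L²}² < δ`
then `limsup (1/r) |‖f_r ∗ (u+v)‖_{L²}² − ‖f_r ∗ u‖_{L²}²| < ε`. -/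
theorem perturbation_continuity (n : ℕ) (hn : 1 ≤ n)
    (f : EuclideanSpace ℝ (Fin n) → ℝ) (hfsm : ContDiff ℝ (⊤ : ℕ∞) f)
    (hfi : Integrable f) (hf0 : (∫ x, f x) = 0)
    (hfd : Integrable fun x => ‖x‖ * |f x|)
    (u : EuclideanSpace ℝ (Fin n) → ℝ) (μu : Measure (EuclideanSpace ℝ (Fin n)))
    (hu : Measurable u) (hub : eLpNorm u ⊤ volume < ⊤)
    (hμu : IsVarMeasure u μu) (hubv : μu Set.univ < ⊤)
    (ε : ℝ) (hε : 0 < ε) :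
    ∃ δ : ℝ, 0 < δ ∧
      ∀ (v : EuclideanSpace ℝ (Fin n) → ℝ) (μv : Measure (EuclideanSpace ℝ (Fin n))),
        Measurable v → eLpNorm v ⊤ volume < ⊤ → IsVarMeasure v μv → μv Set.univ < ⊤ →
        Filter.limsup
            (fun r : ℝ => ENNReal.ofReal r⁻¹ *
              ∫⁻ x, (‖conv (scaleFn f r) v x‖₊ : ℝ≥0∞) ^ 2) (𝓝[>] (0 : ℝ))
          < ENNReal.ofReal δ →
        Filter.limsup
            (fun r : ℝ => ENNReal.ofReal r⁻¹ *
              (((∫⁻ x, (‖conv (scaleFn f r) (fun y => u y + v y) x‖₊ : ℝ≥0∞) ^ 2)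
                  - ∫⁻ x, (‖conv (scaleFn f r) u x‖₊ : ℝ≥0∞) ^ 2)
                ⊔ ((∫⁻ x, (‖conv (scaleFn f r) u x‖₊ : ℝ≥0∞) ^ 2)
                  - ∫⁻ x, (‖conv (scaleFn f r) (fun y => u y + v y) x‖₊ : ℝ≥0∞) ^ 2)))
            (𝓝[>] (0 : ℝ))
          < ENNReal.ofReal ε := by
  have hf := hfsm.continuous
  obtain ⟨u', M, hu', hM, huu⟩ := trunc_aux u hu hub
  set K : ℝ := (μu Set.univ).toReal with hKdef
  have hK0 : 0 ≤ K := ENNReal.toReal_nonneg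
  have hK : ∀ φ : EuclideanSpace ℝ (Fin n) → EuclideanSpace ℝ (Fin n), ContDiff ℝ 1 φ →
      HasCompactSupport φ → (∀ x, ‖φ x‖ ≤ 1) → ∫ x, u' x * divg φ x ≤ K := by
    intro φ h1 h2 h3
    have e : ∫ x, u' x * divg φ x = ∫ x, u x * divg φ x :=
      integral_congr_ae (by filter_upwards [huu] with x hx; rw [hx])
    rw [e, hKdef, ← ENNReal.ofReal_le_iff_le_toReal hubv.ne, hμu Set.univ isOpen_univ]
    exact le_iSup_of_le φ (le_iSup_of_le h1 (le_iSup_of_le h2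
      (le_iSup_of_le (Set.subset_univ _) (le_iSup_of_le h3 le_rfl))))
  have hbd := fun (r : ℝ) (hr : 0 < r) =>
    bound_aux f u' hf hfi hf0 hfd M hu' hM K hK0 hK hr
  set C : ℝ := ((∫ x, |f x|) * M) * (K * ∫ x, ‖x‖ * |f x|) with hC
  have hM0 : 0 ≤ M := (abs_nonneg _).trans (hM 0)
  have hC0 : 0 ≤ C := by
    have i1 : 0 ≤ ∫ x, |f x| := integral_nonneg fun x => abs_nonneg _
    have i2 : 0 ≤ ∫ x, ‖x‖ * |f x| := integral_nonneg fun x => by positivity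
    positivity
  set t : ℝ := ε / (3 * (C + 1)) with ht
  have ht0 : 0 < t := by positivity
  have htC : t * C ≤ ε / 3 := by
    rw [ht, div_mul_eq_mul_div, div_le_div_iff₀ (by positivity) (by positivity)]
    nlinarith
  set δ : ℝ := ε / (3 * (1 + 1 / t)) with hδ
  have hδ0 : 0 < δ := by positivity
  have htδ : (1 + 1 / t) * δ = ε / 3 := by
    rw [hδ]; field_simp
  refine ⟨δ, hδ0, ?_⟩
  intro v μv hv hvb _ _ hlim
  obtain ⟨v', N, hv', hN, hvv⟩ := trunc_aux v hv hvb
  have huv : (fun y => u y + v y) =ᵐ[volume] fun y => u' y + v' y := huu.add hvv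
  have c1 : ∀ r x, conv (scaleFn f r) u x = conv (scaleFn f r) u' x :=
    fun r x => conv_congr_aux _ _ _ huu x
  have c2 : ∀ r x, conv (scaleFn f r) v x = conv (scaleFn f r) v' x :=
    fun r x => conv_congr_aux _ _ _ hvv x
  have c3 : ∀ r x, conv (scaleFn f r) (fun y => u y + v y) x
      = conv (scaleFn f r) (fun y => u' y + v' y) x :=
    fun r x => conv_congr_aux _ _ _ huv x
  simp only [c1, c2, c3] at hlim ⊢
  have hev := eventually_lt_of_limsup_lt hlim
  have hfin : ∀ᶠ r in 𝓝[>] (0:ℝ), ENNReal.ofReal r⁻¹ *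
      (((∫⁻ x, (‖conv (scaleFn f r) (fun y => u' y + v' y) x‖₊ : ℝ≥0∞) ^ 2)
          - ∫⁻ x, (‖conv (scaleFn f r) u' x‖₊ : ℝ≥0∞) ^ 2)
        ⊔ ((∫⁻ x, (‖conv (scaleFn f r) u' x‖₊ : ℝ≥0∞) ^ 2)
          - ∫⁻ x, (‖conv (scaleFn f r) (fun y => u' y + v' y) x‖₊ : ℝ≥0∞) ^ 2))
      ≤ ENNReal.ofReal (2 * ε / 3) := by
    filter_upwards [hev, self_mem_nhdsWithin] with r hr1 (hr : 0 < r)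
    have cadd : ∀ x, conv (scaleFn f r) (fun y => u' y + v' y) x
        = conv (scaleFn f r) u' x + conv (scaleFn f r) v' x := by
      intro x
      simp only [conv_scale_aux _ _ hr, mul_add]
      exact integral_add (int_aux f u' hfi hu' M hM r x) (int_aux f v' hfi hv' N hN r x)
    have mu := conv_meas_aux f u' hf hu' hr
    have mv := conv_meas_aux f v' hf hv' hr
    simp only [cadd]
    set a := conv (scaleFn f r) u'
    set b := conv (scaleFn f r) v'
    have hsplit : ∀ c : EuclideanSpace ℝ (Fin n) → ℝ, 
        ∫⁻ x, ((ENNReal.ofReal t * (‖a x‖₊ : ℝ≥0∞) ^ 2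
          + ENNReal.ofReal (1 + 1 / t) * (‖b x‖₊ : ℝ≥0∞) ^ 2) + (‖c x‖₊ : ℝ≥0∞) ^ 2)
        = (ENNReal.ofReal t * (∫⁻ x, (‖a x‖₊ : ℝ≥0∞) ^ 2)
          + ENNReal.ofReal (1 + 1 / t) * ∫⁻ x, (‖b x‖₊ : ℝ≥0∞) ^ 2)
          + ∫⁻ x, (‖c x‖₊ : ℝ≥0∞) ^ 2 := by
      intro c
      rw [lintegral_add_left (by fun_prop), lintegral_add_left (by fun_prop),
        lintegral_const_mul _ (by fun_prop), lintegral_const_mul _ (by fun_prop)]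
    have d : ((∫⁻ x, (‖a x + b x‖₊ : ℝ≥0∞) ^ 2) - ∫⁻ x, (‖a x‖₊ : ℝ≥0∞) ^ 2)
        ⊔ ((∫⁻ x, (‖a x‖₊ : ℝ≥0∞) ^ 2) - ∫⁻ x, (‖a x + b x‖₊ : ℝ≥0∞) ^ 2)
        ≤ ENNReal.ofReal t * (∫⁻ x, (‖a x‖₊ : ℝ≥0∞) ^ 2)
          + ENNReal.ofReal (1 + 1 / t) * ∫⁻ x, (‖b x‖₊ : ℝ≥0∞) ^ 2 := by
      refine sup_le ?_ ?_ <;> rw [tsub_le_iff_right, ← hsplit] <;>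
        refine lintegral_mono fun x => ?_
      · exact (pt_aux (a x) (b x) t ht0).1
      · exact (pt_aux (a x) (b x) t ht0).2
    have hA : ENNReal.ofReal r⁻¹ * (∫⁻ x, (‖a x‖₊ : ℝ≥0∞) ^ 2) ≤ ENNReal.ofReal C := by
      calc _ ≤ ENNReal.ofReal r⁻¹ * (ENNReal.ofReal r * ENNReal.ofReal C) := by
            gcongr
            exact hbd r hr
        _ = _ := by
            rw [← mul_assoc, ← ENNReal.ofReal_mul (by positivity), inv_mul_cancel₀ hr.ne',
              ENNReal.ofReal_one, one_mul]
    calc _ ≤ ENNReal.ofReal r⁻¹ * (ENNReal.ofReal t * (∫⁻ x, (‖a x‖₊ : ℝ≥0∞) ^ 2)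
          + ENNReal.ofReal (1 + 1 / t) * ∫⁻ x, (‖b x‖₊ : ℝ≥0∞) ^ 2) := by gcongr
      _ = ENNReal.ofReal t * (ENNReal.ofReal r⁻¹ * (∫⁻ x, (‖a x‖₊ : ℝ≥0∞) ^ 2))
          + ENNReal.ofReal (1 + 1 / t) *
            (ENNReal.ofReal r⁻¹ * ∫⁻ x, (‖b x‖₊ : ℝ≥0∞) ^ 2) := by ring
      _ ≤ ENNReal.ofReal t * ENNReal.ofReal C + ENNReal.ofReal (1 + 1 / t) * ENNReal.ofReal δ := by
          gcongr
      _ = ENNReal.ofReal (t * C + (1 + 1 / t) * δ) := by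
          rw [← ENNReal.ofReal_mul ht0.le, ← ENNReal.ofReal_mul (by positivity),
            ← ENNReal.ofReal_add (by positivity) (by positivity)]
      _ ≤ _ := ENNReal.ofReal_le_ofReal (by linarith)
  refine (limsup_le_of_le (by isBoundedDefault) hfin).trans_lt ?_
  exact (ENNReal.ofReal_lt_ofReal_iff hε).2 (by linarith)
end
end
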